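/- arXiv:2008.08348 — 2 statements merged into one kernel-verified Lean document; each statement's English description precedes it below -/
import Mathlib

section
/- Let b : ℝ → ℝ be locally Lipschitz, nonnegative and nondecreasing, let t₀ ∈ ℝ, T > t₀, and let 0 < α < α̃ and 0 < β < β̃. Suppose y : [t₀, T) → ℝ is continuous and satisfies y(t) = α + β(t − t₀) + ∫_{t₀}^t (t − s) b(y(s)) ds for all t ∈ [t₀, T), and ỹ : [t₀, T) → ℝ is continuous and satisfies ỹ(t) ≥ α̃ + β̃(t − t₀) + ∫_{t₀}^t (t − s) b(ỹ(s)) ds for all t ∈ [t₀, T). Then y(t) ≤ ỹ(t) for all t ∈ [t₀, T). -/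
open MeasureTheory Set

/-- Reverse comparison principle: a solution of the integral equation with
smaller data is dominated by any continuous supersolution with larger data,
up to the (common) blow-up time `T`. -/
theorem comparison_supersolution (b : ℝ → ℝ) (hb : LocallyLipschitz b)
    (hb_nonneg : ∀ x, 0 ≤ b x) (hb_mono : Monotone b)
    (t₀ T α β α' β' : ℝ) (hT : t₀ < T)
    (hα : 0 < α) (hαα : α < α') (hβ : 0 < β) (hββ : β < β')
    (y ytil : ℝ → ℝ)
    (hy_cont : ContinuousOn y (Set.Ico t₀ T))
    (hytil_cont : ContinuousOn ytil (Set.Ico t₀ T))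
    (hy_eq : ∀ t ∈ Set.Ico t₀ T,
      y t = α + β * (t - t₀) + ∫ s in t₀..t, (t - s) * b (y s))
    (hytil_ge : ∀ t ∈ Set.Ico t₀ T,
      α' + β' * (t - t₀) + (∫ s in t₀..t, (t - s) * b (ytil s)) ≤ ytil t) :
    ∀ t ∈ Set.Ico t₀ T, y t ≤ ytil t := by
  intro t₁ ht₁
  by_contra hlt
  have hle : ytil t₁ ≤ y t₁ := (not_le.mp hlt).le
  have hsub : Set.Icc t₀ t₁ ⊆ Set.Ico t₀ T := fun x hx => ⟨hx.1, lt_of_le_of_lt hx.2 ht₁.2⟩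
  have hclosed : IsClosed (Set.Icc t₀ t₁ ∩ (fun t => ytil t - y t) ⁻¹' Set.Iic 0) :=
    ((hytil_cont.mono hsub).sub (hy_cont.mono hsub)).preimage_isClosed_of_isClosed
      isClosed_Icc isClosed_Iic
  have hcomp : IsCompact (Set.Icc t₀ t₁ ∩ (fun t => ytil t - y t) ⁻¹' Set.Iic 0) :=
    isCompact_Icc.of_isClosed_subset hclosed Set.inter_subset_left
  obtain ⟨c, ⟨hcI, hc0⟩, hcmin⟩ := hcomp.exists_isLeast
    ⟨t₁, ⟨ht₁.1, le_refl _⟩, by simpa using hle⟩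
  have hc0' : ytil c - y c ≤ 0 := hc0
  have hsubc : Set.Icc t₀ c ⊆ Set.Ico t₀ T := fun x hx => hsub ⟨hx.1, hx.2.trans hcI.2⟩
  have hint : ∀ f : ℝ → ℝ, ContinuousOn f (Set.Ico t₀ T) →
      IntervalIntegrable (fun s => (c - s) * b (f s)) volume t₀ c := by
    intro f hf
    apply ContinuousOn.intervalIntegrable_of_Icc hcI.1
    exact (continuousOn_const.sub continuousOn_id).mul
      (hb.continuous.comp_continuousOn (hf.mono hsubc))
  have hmono : (∫ s in t₀..c, (c - s) * b (y s)) ≤ ∫ s in t₀..c, (c - s) * b (ytil s) := by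
    apply intervalIntegral.integral_mono_on hcI.1 (hint y hy_cont) (hint ytil hytil_cont)
    intro s hs
    rcases hs.2.eq_or_lt with h | h
    · simp [h]
    · apply mul_le_mul_of_nonneg_left _ (by linarith)
      apply hb_mono
      by_contra hcon
      have hs' : ytil s - y s ≤ 0 := by linarith [not_le.mp hcon]
      have := hcmin ⟨⟨hs.1, hs.2.trans hcI.2⟩, hs'⟩
      linarith
  have h1 := hy_eq c (hsub hcI)
  have h2 := hytil_ge c (hsub hcI)
  have h3 : β * (c - t₀) ≤ β' * (c - t₀) :=
    mul_le_mul_of_nonneg_right hββ.le (by linarith [hcI.1])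
  linarith
end

section
/- Let b : ℝ → ℝ be locally Lipschitz, nonnegative and nondecreasing, let A, B ≥ 0, and let g : [0, ∞) → ℝ be continuous with limsup_{t → ∞} inf_{0 ≤ h ≤ 1} g(t + h) = ∞. Suppose that T(α, β) := ∫_α^∞ ds / (β² + 2∫_α^s b(r) dr)^{1/2} is finite for some α > 0 and β > 0. Then there is no continuous function X : [0, ∞) → ℝ satisfying X(t) = A + B·t + ∫_0^t (t − s) b(X(s)) ds + g(t) for all t ≥ 0; that is, every solution of this integral equation blows up in finite time. -/
open MeasureTheory Set Filter

/-- `T(α,β) = ∫_α^∞ ds / (β² + 2∫_α^s b(r) dr)^{1/2}`, valued in `[0,∞]`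
(with the convention `1/0 = ∞`, which is irrelevant here since the integrand's
denominator is positive when `β > 0`). -/
noncomputable def blowupTime (b : ℝ → ℝ) (α β : ℝ) : ENNReal :=
  ∫⁻ s in Set.Ioi α, ENNReal.ofReal (1 / Real.sqrt (β ^ 2 + 2 * ∫ r in α..s, b r))

lemma aux_mono {f f' : ℝ → ℝ} {a c : ℝ} (hf : ∀ t, HasDerivAt f (f' t) t)
    (h : ∀ t ∈ Icc a c, 0 ≤ f' t) {x y : ℝ} (hx : x ∈ Icc a c) (hy : y ∈ Icc a c)
    (hxy : x ≤ y) : f x ≤ f y := by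
  have : MonotoneOn f (Icc a c) := by
    apply monotoneOn_of_deriv_nonneg (convex_Icc a c)
    · exact fun t _ => (hf t).continuousAt.continuousWithinAt
    · exact fun t _ => (hf t).differentiableAt.differentiableWithinAt
    · intro t ht
      rw [(hf t).deriv]
      exact h t (interior_subset ht)
  exact this hx hy hxy

lemma aux_int {f : ℝ → ℝ} (hf : Continuous f) (a : ℝ) (t : ℝ) :
    HasDerivAt (fun t => ∫ s in a..t, f s) (f t) t :=
  intervalIntegral.integral_hasDerivAt_right (hf.intervalIntegrable _ _)
    (hf.stronglyMeasurableAtFilter _ _) hf.continuousAt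

/-- Consequences of the Osgood-type condition. -/
lemma aux_osgood (b : ℝ → ℝ) (hbc : Continuous b)
    (hb_nonneg : ∀ x, 0 ≤ b x) (hb_mono : Monotone b)
    (α β : ℝ) (hα : 0 < α) (hβ : 0 < β) (hfin : blowupTime b α β < ⊤) :
    ∃ (H φ : ℝ → ℝ) (N : ℝ), α ≤ N ∧ 8 * N ≤ b N ∧
      (∀ y, HasDerivAt H (φ y) y) ∧
      (∀ y, N ≤ y → ∃ F : ℝ, F = β ^ 2 + 2 * ∫ r in α..y, b r ∧ 2 * β ^ 2 ≤ F ∧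
        φ y = 1 / Real.sqrt F) ∧
      (∀ y z, N ≤ y → N ≤ z → H z - H y < 1 / 4) := by
  set F : ℝ → ℝ := fun s => β ^ 2 + 2 * ∫ r in α..s, b r with hF
  have hFc : Continuous F := by
    have : Continuous fun s => ∫ r in α..s, b r :=
      continuous_iff_continuousAt.2 fun t => (aux_int hbc α t).continuousAt
    fun_prop
  have hFmono : Monotone F := by
    apply monotone_of_deriv_nonneg
    · intro t
      exact (((aux_int hbc α t).const_mul 2).const_add _).differentiableAt
    · intro t
      rw [(((aux_int hbc α t).const_mul 2).const_add _).deriv]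
      have := hb_nonneg t
      positivity
  have hFα : F α = β ^ 2 := by simp [hF]
  have hFpos : ∀ s, α ≤ s → 0 < F s := fun s hs => by
    have := hFmono hs
    rw [hFα] at this
    have : 0 < β ^ 2 := by positivity
    linarith
  set φ : ℝ → ℝ := fun s => 1 / Real.sqrt (F (max s α)) with hφ
  have hφc : Continuous φ := by
    apply Continuous.div continuous_const
    · exact Real.continuous_sqrt.comp (hFc.comp (by fun_prop))
    · intro s
      exact (Real.sqrt_pos.2 (hFpos _ (le_max_right _ _))).ne'
  have hφnn : ∀ s, 0 ≤ φ s := fun s => by positivity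
  have hint : IntegrableOn φ (Ioi α) := by
    refine ⟨hφc.aestronglyMeasurable, ?_⟩
    rw [hasFiniteIntegral_iff_ofReal (Eventually.of_forall hφnn)]
    refine lt_of_eq_of_lt ?_ hfin
    unfold blowupTime
    apply setLIntegral_congr_fun measurableSet_Ioi
    intro s hs
    simp only [hφ, hF, max_eq_left (le_of_lt (mem_Ioi.1 hs))]
  set H : ℝ → ℝ := fun y => ∫ s in α..y, φ s with hH
  have hHt : Tendsto H atTop (nhds (∫ s in Ioi α, φ s)) :=
    intervalIntegral_tendsto_integral_Ioi α hint tendsto_id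
  have hHd : ∀ y, HasDerivAt H (φ y) y := fun y => aux_int hφc α y
  obtain ⟨N₀, hN₀⟩ := (Metric.tendsto_atTop.1 hHt) (1 / 40) (by norm_num)
  have hC : ∀ y z, N₀ ≤ y → N₀ ≤ z → H z - H y < 1 / 16 := by
    intro y z hy hz
    have h1 := hN₀ y hy
    have h2 := hN₀ z hz
    rw [Real.dist_eq, abs_lt] at h1 h2
    linarith [h1.1, h1.2, h2.1, h2.2]
  set m := max (max N₀ α) β with hm
  have hm1 : N₀ ≤ m := (le_max_left _ _).trans (le_max_left _ _)
  have hm2 : α ≤ m := (le_max_right _ _).trans (le_max_left _ _)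
  have hm3 : β ≤ m := le_max_right _ _
  have hm0 : 0 < m := by linarith
  have hF2 : 256 * m ^ 2 ≤ F (2 * m) := by
    have h1 := hC m (2 * m) hm1 (by linarith)
    have h2 : m * φ (2 * m) ≤ H (2 * m) - H m := by
      have h3 := aux_mono (f := fun y => H y - y * φ (2 * m)) (a := m) (c := 2 * m)
        (fun t => (hHd t).sub ((hasDerivAt_id t).mul_const _)) (by
          intro t ht
          have : φ (2 * m) ≤ φ t := by
            simp only [hφ]
            apply one_div_le_one_div_of_le (Real.sqrt_pos.2 (hFpos _ (le_max_right _ _)))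
            exact Real.sqrt_le_sqrt (hFmono (max_le_max_right _ ht.2))
          linarith) (x := m) (y := 2 * m) ⟨le_rfl, by linarith⟩ ⟨by linarith, le_rfl⟩
          (by linarith)
      linarith
    have h4 : φ (2 * m) = 1 / Real.sqrt (F (2 * m)) := by
      simp only [hφ]; rw [max_eq_left (by linarith)]
    have hp := hFpos (2 * m) (by linarith)
    have hsp := Real.sqrt_pos.2 hp
    have h5 : m / Real.sqrt (F (2 * m)) < 1 / 16 := by
      rw [h4] at h2
      rw [div_eq_mul_one_div]; linarith
    rw [div_lt_iff₀ hsp] at h5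
    have h6 := Real.sq_sqrt hp.le
    nlinarith
  have hF3 : F (2 * m) ≤ β ^ 2 + 4 * m * b (2 * m) := by
    have : ∫ r in α..(2 * m), b r ≤ ∫ r in α..(2 * m), b (2 * m) := by
      apply intervalIntegral.integral_mono_on (by linarith) (hbc.intervalIntegrable _ _)
        (by simp)
      intro x hx
      exact hb_mono hx.2
    rw [intervalIntegral.integral_const, smul_eq_mul] at this
    have h0 := hb_nonneg (2 * m)
    simp only [hF]
    nlinarith
  refine ⟨H, φ, 2 * m, by linarith, ?_, hHd, ?_, ?_⟩
  · have : 255 * m ^ 2 ≤ 4 * m * b (2 * m) := by nlinarith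
    have : m * (255 * m) ≤ m * (4 * b (2 * m)) := by linarith
    have := le_of_mul_le_mul_left this hm0
    linarith
  · intro y hy
    refine ⟨F y, rfl, ?_, ?_⟩
    · have := hFmono hy
      nlinarith
    · simp only [hφ]; rw [max_eq_left (by linarith)]
  · intro y z hy hz
    have := hC y z (by linarith) (by linarith)
    linarith

/-- If `g` satisfies `limsup_{t→∞} inf_{0≤h≤1} g(t+h) = ∞` and `T(α,β) < ∞`
for some `α, β > 0`, then no global continuous solution of
`X(t) = A + Bt + ∫₀ᵗ (t-s) b(X(s)) ds + g(t)` on `[0,∞)` exists. -/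
theorem no_global_solution (b : ℝ → ℝ) (hb : LocallyLipschitz b)
    (hb_nonneg : ∀ x, 0 ≤ b x) (hb_mono : Monotone b)
    (A B : ℝ) (hA : 0 ≤ A) (hB : 0 ≤ B)
    (g : ℝ → ℝ) (hg_cont : ContinuousOn g (Set.Ici 0))
    (hg_limsup : ∀ M : ℝ, ∃ᶠ t in atTop, ∀ h ∈ Set.Icc (0 : ℝ) 1, M ≤ g (t + h))
    (α β : ℝ) (hα : 0 < α) (hβ : 0 < β) (hfin : blowupTime b α β < ⊤) :
    ¬ ∃ X : ℝ → ℝ, ContinuousOn X (Set.Ici 0) ∧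
      ∀ t : ℝ, 0 ≤ t →
        X t = A + B * t + (∫ s in (0 : ℝ)..t, (t - s) * b (X s)) + g t := by
  rintro ⟨X, hX, hXe⟩
  have hbc : Continuous b := hb.continuous
  obtain ⟨H, φ, M, hαM, hbM, hHd, hφ, hHC⟩ :=
    aux_osgood b hbc hb_nonneg hb_mono α β hα hβ hfin
  obtain ⟨t₀, hgt, ht₀⟩ := ((hg_limsup M).and_eventually (eventually_ge_atTop 0)).exists
  -- continuous extension
  set f : ℝ → ℝ := fun s => b (X (max s 0)) with hf
  have hfc : Continuous f := by
    apply hbc.comp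
    exact hX.comp_continuous (by fun_prop) (fun s => le_max_right s 0)
  have hfnn : ∀ s, 0 ≤ f s := fun s => hb_nonneg _
  set V : ℝ → ℝ := fun t => ∫ s in t₀..t, f s with hV
  set Y : ℝ → ℝ := fun t => M + (t * V t - ∫ s in t₀..t, s * f s) with hY
  have hVd : ∀ t, HasDerivAt V (f t) t := aux_int hfc t₀
  have hYd : ∀ t, HasDerivAt Y (V t) t := by
    intro t
    have h1 := aux_int (f := fun s => s * f s) (by fun_prop) t₀ t
    have h2 := ((((hasDerivAt_id t).mul (hVd t)).sub h1).const_add M)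
    have h3 : V t = 1 * V t + t * f t - t * f t := by ring
    rw [h3]
    exact h2
  have hV0 : V t₀ = 0 := by simp [hV]
  have hY0 : Y t₀ = M := by simp [hY, hV]
  have hXY : ∀ t ∈ Icc t₀ (t₀ + 1), Y t ≤ X t := by
    intro t ht
    have htp : 0 ≤ t := ht₀.trans ht.1
    have e1 : ∫ s in (0 : ℝ)..t, (t - s) * b (X s) = ∫ s in (0 : ℝ)..t, (t - s) * f s := by
      apply intervalIntegral.integral_congr
      intro s hs
      rw [uIcc_of_le htp] at hs
      simp only [hf, max_eq_left hs.1]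
    have hc : Continuous fun s => (t - s) * f s := by fun_prop
    have e2 := intervalIntegral.integral_add_adjacent_intervals
      (hc.intervalIntegrable (μ := volume) 0 t₀) (hc.intervalIntegrable t₀ t)
    have e3 : 0 ≤ ∫ s in (0 : ℝ)..t₀, (t - s) * f s := by
      apply intervalIntegral.integral_nonneg ht₀
      intro s hs
      exact mul_nonneg (by linarith [hs.2, ht.1]) (hfnn s)
    have e4 : ∫ s in t₀..t, (t - s) * f s = t * V t - ∫ s in t₀..t, s * f s := by
      simp only [hV]
      rw [← intervalIntegral.integral_const_mul, ← intervalIntegral.integral_sub]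
      · congr 1; ext s; ring
      · exact Continuous.intervalIntegrable (by fun_prop) _ _
      · exact Continuous.intervalIntegrable (by fun_prop) _ _
    have e5 := hgt (t - t₀) ⟨by linarith [ht.1], by linarith [ht.2]⟩
    rw [add_sub_cancel] at e5
    have e6 := hXe t htp
    have e7 : 0 ≤ B * t := mul_nonneg hB htp
    simp only [hY]
    linarith
  have hfY : ∀ t ∈ Icc t₀ (t₀ + 1), b (Y t) ≤ f t := by
    intro t ht
    simp only [hf, max_eq_left (ht₀.trans ht.1)]
    exact hb_mono (hXY t ht)
  have hm0 : t₀ ∈ Icc t₀ (t₀ + 1) := ⟨le_rfl, by linarith⟩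
  have hVnn : ∀ t ∈ Icc t₀ (t₀ + 1), 0 ≤ V t := by
    intro t ht
    rw [← hV0]
    exact aux_mono hVd (fun s _ => hfnn s) hm0 ht ht.1
  have hYM : ∀ t ∈ Icc t₀ (t₀ + 1), M ≤ Y t := by
    intro t ht
    rw [← hY0]
    exact aux_mono hYd hVnn hm0 ht ht.1
  have hVlow : ∀ t ∈ Icc t₀ (t₀ + 1), b M * (t - t₀) ≤ V t := by
    intro t ht
    have := aux_mono (f := fun t => V t - b M * (t - t₀)) (a := t₀) (c := t₀ + 1)
      (fun t => (hVd t).sub (((hasDerivAt_id t).sub_const t₀).const_mul (b M))) (by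
        intro s hs
        have h1 := hfY s hs
        have h2 := hb_mono (hYM s hs)
        linarith) hm0 ht ht.1
    simp only [hV0, sub_self, mul_zero] at this
    linarith
  have hYlow : 2 * M ≤ Y (t₀ + 1 / 2) := by
    have := aux_mono (f := fun t => Y t - b M * (t - t₀) ^ 2 / 2) (a := t₀) (c := t₀ + 1)
      (fun t => (hYd t).sub (((((hasDerivAt_id t).sub_const t₀).pow 2).const_mul
        (b M)).div_const 2)) (by
        intro s hs
        have h1 := hVlow s hs
        simp
        linarith) hm0 (y := t₀ + 1 / 2) ⟨by linarith, by linarith⟩ (by linarith)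
    simp only [hY0, sub_self, add_sub_cancel_left] at this
    norm_num at this
    norm_num
    linarith
  have hMpos : 0 < M := by linarith
  have hE : ∀ t ∈ Icc t₀ (t₀ + 1), 2 * ∫ r in M..(Y t), b r ≤ V t ^ 2 := by
    intro t ht
    have := aux_mono (f := fun t => V t ^ 2 - 2 * ∫ r in M..(Y t), b r) (a := t₀) (c := t₀ + 1)
      (fun t => ((hVd t).pow 2).sub (((aux_int hbc M (Y t)).comp t (hYd t)).const_mul 2)) (by
        intro s hs
        have h1 := hfY s hs
        have h2 := hVnn s hs
        simp
        nlinarith) hm0 ht ht.1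
    simp only [hV0, hY0, intervalIntegral.integral_same] at this
    norm_num at this
    linarith
  have hfinal := aux_mono (f := fun t => H (Y t) - t / 2) (a := t₀ + 1 / 2) (c := t₀ + 1)
    (fun t => ((hHd (Y t)).comp t (hYd t)).sub ((hasDerivAt_id t).div_const 2)) (by
      intro t ht
      have ht' : t ∈ Icc t₀ (t₀ + 1) := ⟨by linarith [ht.1], ht.2⟩
      have hY2 : 2 * M ≤ Y t := hYlow.trans
        (aux_mono hYd hVnn ⟨by linarith, by linarith⟩ ht' ht.1)
      obtain ⟨F, hFe, hFb, hφe⟩ := hφ (Y t) (by linarith)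
      have i1 : ∫ r in α..M, b r ≤ ∫ r in α..M, b M := by
        apply intervalIntegral.integral_mono_on hαM (hbc.intervalIntegrable _ _) (by simp)
        intro x hx
        exact hb_mono hx.2
      have i2 : ∫ r in M..(Y t), b M ≤ ∫ r in M..(Y t), b r := by
        apply intervalIntegral.integral_mono_on (by linarith) (by simp)
          (hbc.intervalIntegrable _ _)
        intro x hx
        exact hb_mono hx.1
      rw [intervalIntegral.integral_const, smul_eq_mul] at i1 i2
      have i3 := intervalIntegral.integral_add_adjacent_intervals
        (hbc.intervalIntegrable (μ := volume) α M) (hbc.intervalIntegrable M (Y t))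
      have i4 : (M - α) * b M ≤ (Y t - M) * b M :=
        mul_le_mul_of_nonneg_right (by linarith) (hb_nonneg M)
      have i5 := hE t ht'
      have i6 : F / 4 ≤ V t ^ 2 := by linarith
      have hFp : 0 < F := by
        have : 0 < β ^ 2 := by positivity
        linarith
      have i7 : Real.sqrt F ≤ 2 * V t := by
        apply Real.sqrt_le_iff.2
        exact ⟨by linarith [hVnn t ht'], by nlinarith⟩
      have hsp := Real.sqrt_pos.2 hFp
      have i8 : 1 / 2 ≤ φ (Y t) * V t := by
        rw [hφe, one_div_mul_eq_div, le_div_iff₀ hsp]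
        linarith
      linarith) (x := t₀ + 1 / 2) (y := t₀ + 1) ⟨le_rfl, by linarith⟩
      ⟨by linarith, le_rfl⟩ (by linarith)
  have := hHC (Y (t₀ + 1 / 2)) (Y (t₀ + 1)) (by linarith)
    (hYM _ ⟨by linarith, le_rfl⟩)
  linarith
end
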